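/- Let a = a₁ e₁ + u ∈ ℝ^{2n+1} with u ∈ V₀ and u ≠ 0, and let L_a(x) = a ∗ x. Then ℝ^{2n+1} decomposes as the internal direct sum of two L_a-invariant subspaces: E_{a₁} := ker(L_a − a₁·id) = { v : v·e₁ = 0 and u·v = ω(u, v) }, which has dimension 2n − 1, and E₂ := ker(L_a² − 2a₁ L_a + (a₁² + ‖u‖²)·id) = span{e₁, u}, which has dimension 2. -/

import Mathlib

noncomputable section

/-- Standard dot product on `ℝ^m`. -/
def dot {m : ℕ} (a b : Fin m → ℝ) : ℝ := ∑ i, a i * b i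

/-- The distinguished unit vector `e₁` of the Vidinli algebra (index `0`). -/
def e1 (n : ℕ) : Fin (2*n+1) → ℝ := fun i => if i.val = 0 then 1 else 0

/-- The standard symplectic form `ω` on `ℝ^{2n+1}` (vanishing on `e₁`):
`ω(a,b) = Σ_{k=1}^n (a_{2k} b_{2k+1} − a_{2k+1} b_{2k})` in the paper's 1-based indexing. -/
def omg (n : ℕ) (a b : Fin (2*n+1) → ℝ) : ℝ :=
  ∑ k : Fin n,
    (a ⟨2*k.val+1, by have := k.isLt; omega⟩ * b ⟨2*k.val+2, by have := k.isLt; omega⟩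
   - a ⟨2*k.val+2, by have := k.isLt; omega⟩ * b ⟨2*k.val+1, by have := k.isLt; omega⟩)

/-- The Vidinli multiplication on `ℝ^{2n+1}`. -/
def vprod (n : ℕ) (a b : Fin (2*n+1) → ℝ) : Fin (2*n+1) → ℝ :=
  dot a (e1 n) • b + dot b (e1 n) • a - dot a b • e1 n + omg n a b • e1 n

lemma dot_add_right {m : ℕ} (a b c : Fin m → ℝ) :
    dot a (b + c) = dot a b + dot a c := by
  simp [dot, mul_add, Finset.sum_add_distrib]

lemma dot_smul_right {m : ℕ} (c : ℝ) (a b : Fin m → ℝ) :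
    dot a (c • b) = c * dot a b := by
  simp only [dot, Pi.smul_apply, smul_eq_mul, Finset.mul_sum]
  exact Finset.sum_congr rfl fun i _ => by ring

lemma dot_add_left {m : ℕ} (a b c : Fin m → ℝ) :
    dot (a + b) c = dot a c + dot b c := by
  simp [dot, add_mul, Finset.sum_add_distrib]

lemma dot_smul_left {m : ℕ} (c : ℝ) (a b : Fin m → ℝ) :
    dot (c • a) b = c * dot a b := by
  simp only [dot, Pi.smul_apply, smul_eq_mul, Finset.mul_sum]
  exact Finset.sum_congr rfl fun i _ => by ring

lemma omg_add_right (n : ℕ) (a b c : Fin (2*n+1) → ℝ) :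
    omg n a (b + c) = omg n a b + omg n a c := by
  simp only [omg, Pi.add_apply]
  rw [← Finset.sum_add_distrib]
  exact Finset.sum_congr rfl fun k _ => by ring

lemma omg_smul_right (n : ℕ) (c : ℝ) (a b : Fin (2*n+1) → ℝ) :
    omg n a (c • b) = c * omg n a b := by
  simp only [omg, Pi.smul_apply, smul_eq_mul, Finset.mul_sum]
  exact Finset.sum_congr rfl fun k _ => by ring

lemma omg_add_left (n : ℕ) (a b c : Fin (2*n+1) → ℝ) :
    omg n (a + b) c = omg n a c + omg n b c := by
  simp only [omg, Pi.add_apply]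
  rw [← Finset.sum_add_distrib]
  exact Finset.sum_congr rfl fun k _ => by ring

lemma omg_smul_left (n : ℕ) (c : ℝ) (a b : Fin (2*n+1) → ℝ) :
    omg n (c • a) b = c * omg n a b := by
  simp only [omg, Pi.smul_apply, smul_eq_mul, Finset.mul_sum]
  exact Finset.sum_congr rfl fun k _ => by ring

/-- Left multiplication `L_a(x) = a ∗ x` as a linear map. -/
def Lmul (n : ℕ) (a : Fin (2*n+1) → ℝ) :
    (Fin (2*n+1) → ℝ) →ₗ[ℝ] (Fin (2*n+1) → ℝ) where
  toFun x := vprod n a x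
  map_add' x y := by
    simp only [vprod, dot_add_right, omg_add_right, dot_add_left]
    module
  map_smul' c x := by
    simp only [vprod, dot_smul_right, omg_smul_right, dot_smul_left, RingHom.id_apply]
    module

/-- Right multiplication `R_a(x) = x ∗ a` as a linear map. -/
def Rmul (n : ℕ) (a : Fin (2*n+1) → ℝ) :
    (Fin (2*n+1) → ℝ) →ₗ[ℝ] (Fin (2*n+1) → ℝ) where
  toFun x := vprod n x a
  map_add' x y := by
    simp only [vprod, dot_add_left, omg_add_left, dot_add_right]
    module
  map_smul' c x := by
    simp only [vprod, dot_smul_left, omg_smul_left, dot_smul_right, RingHom.id_apply]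
    module

lemma dot_symm {m : ℕ} (a b : Fin m → ℝ) : dot a b = dot b a :=
  Finset.sum_congr rfl fun _ _ => mul_comm _ _

lemma dot_self_ne_zero {m : ℕ} {a : Fin m → ℝ} (ha : a ≠ 0) : dot a a ≠ 0 :=
  fun h => ha (dotProduct_self_eq_zero.mp h)

lemma dot_e1_right (n : ℕ) (x : Fin (2*n+1) → ℝ) : dot x (e1 n) = x 0 := by
  rw [dot, Finset.sum_eq_single 0]
  · simp [e1]
  · intro i _ hi
    simp [e1, hi]
  · simp

lemma dot_e1_self (n : ℕ) : dot (e1 n) (e1 n) = 1 := by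
  simp [dot_e1_right, e1]

lemma omg_e1_left (n : ℕ) (x : Fin (2*n+1) → ℝ) : omg n (e1 n) x = 0 := by
  simp [omg, e1]

lemma omg_e1_right (n : ℕ) (x : Fin (2*n+1) → ℝ) : omg n x (e1 n) = 0 := by
  simp [omg, e1]

lemma omg_self (n : ℕ) (x : Fin (2*n+1) → ℝ) : omg n x x = 0 :=
  Finset.sum_eq_zero fun _ _ => by ring

section LeftMultiplication

variable {n : ℕ} {u : Fin (2*n+1) → ℝ}

lemma Lmul_apply_of_dot_e1_eq_zero (hu : dot u (e1 n) = 0) (a₁ : ℝ) (x : Fin (2*n+1) → ℝ) :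
    Lmul n (a₁ • e1 n + u) x
      = a₁ • x + dot x (e1 n) • u + (omg n u x - dot u x) • e1 n := by
  change vprod n (a₁ • e1 n + u) x = _
  simp only [vprod, dot_add_left, dot_smul_left, omg_add_left, omg_smul_left, dot_e1_self,
    omg_e1_left, hu, dot_symm (e1 n) x]
  module

lemma linearIndependent_e1_pair (hu : dot u (e1 n) = 0) (hu0 : u ≠ 0) :
    LinearIndependent ℝ ![e1 n, u] := by
  rw [LinearIndependent.pair_iff]
  intro s t h
  have hs : s = 0 := by
    have := congrArg (fun y => dot y (e1 n)) h
    simpa [dot_add_left, dot_smul_left, dot_e1_self, hu, dot_e1_right n 0] using this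
  subst hs
  simpa [hu0] using h

lemma mem_ker_Lmul_sub_smul_id (hu : dot u (e1 n) = 0) (hu0 : u ≠ 0) (a₁ : ℝ)
    (x : Fin (2*n+1) → ℝ) :
    x ∈ LinearMap.ker (Lmul n (a₁ • e1 n + u) - a₁ • LinearMap.id) ↔
      dot x (e1 n) = 0 ∧ dot u x = omg n u x := by
  have key : (Lmul n (a₁ • e1 n + u) - a₁ • LinearMap.id : Module.End ℝ (Fin (2*n+1) → ℝ)) x
      = (omg n u x - dot u x) • e1 n + dot x (e1 n) • u := by
    simp only [LinearMap.sub_apply, LinearMap.smul_apply, LinearMap.id_apply,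
      Lmul_apply_of_dot_e1_eq_zero hu]
    module
  rw [LinearMap.mem_ker, key]
  constructor
  · intro h
    obtain ⟨h1, h2⟩ := LinearIndependent.pair_iff.mp (linearIndependent_e1_pair hu hu0) _ _ h
    exact ⟨h2, by linarith⟩
  · rintro ⟨h1, h2⟩
    simp [h1, h2]

lemma mem_ker_quadratic_Lmul (hu : dot u (e1 n) = 0) (a₁ : ℝ) (x : Fin (2*n+1) → ℝ) :
    x ∈ LinearMap.ker (Lmul n (a₁ • e1 n + u) ∘ₗ Lmul n (a₁ • e1 n + u)
        - (2*a₁) • Lmul n (a₁ • e1 n + u) + (a₁^2 + dot u u) • LinearMap.id) ↔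
      dot u u • x = (dot u u * dot x (e1 n)) • e1 n + (dot u x - omg n u x) • u := by
  rw [LinearMap.mem_ker, ← sub_eq_zero (a := dot u u • x)]
  simp only [LinearMap.add_apply, LinearMap.sub_apply, LinearMap.smul_apply,
    LinearMap.comp_apply, LinearMap.id_apply, Lmul_apply_of_dot_e1_eq_zero hu,
    dot_add_left, dot_add_right, dot_smul_left, dot_smul_right, omg_add_right, omg_smul_right,
    dot_e1_self, omg_e1_right, omg_self, hu]
  refine Eq.congr_left ?_
  module

lemma ker_quadratic_Lmul_eq_span (hu : dot u (e1 n) = 0) (hu0 : u ≠ 0) (a₁ : ℝ) :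
    LinearMap.ker (Lmul n (a₁ • e1 n + u) ∘ₗ Lmul n (a₁ • e1 n + u)
        - (2*a₁) • Lmul n (a₁ • e1 n + u) + (a₁^2 + dot u u) • LinearMap.id)
      = Submodule.span ℝ {e1 n, u} := by
  ext x
  rw [mem_ker_quadratic_Lmul hu, Submodule.mem_span_pair]
  have hs := dot_self_ne_zero hu0
  constructor
  · intro h
    refine ⟨dot x (e1 n), (dot u u)⁻¹ * (dot u x - omg n u x), ?_⟩
    apply smul_right_injective _ hs
    simp only [h, smul_add, smul_smul, mul_inv_cancel_left₀ hs]
  · rintro ⟨s, t, rfl⟩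
    simp only [dot_add_left, dot_add_right, dot_smul_left, dot_smul_right, omg_add_right,
      omg_smul_right, dot_e1_self, omg_e1_right, omg_self, hu]
    module

lemma isCompl_ker_Lmul (hu : dot u (e1 n) = 0) (hu0 : u ≠ 0) (a₁ : ℝ) :
    IsCompl (LinearMap.ker (Lmul n (a₁ • e1 n + u) - a₁ • LinearMap.id))
      (LinearMap.ker (Lmul n (a₁ • e1 n + u) ∘ₗ Lmul n (a₁ • e1 n + u)
        - (2*a₁) • Lmul n (a₁ • e1 n + u) + (a₁^2 + dot u u) • LinearMap.id)) := by
  have hs := dot_self_ne_zero hu0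
  constructor
  · rw [Submodule.disjoint_def]
    intro x h1 h2
    rw [mem_ker_Lmul_sub_smul_id hu hu0] at h1
    rw [mem_ker_quadratic_Lmul hu, h1.1, h1.2] at h2
    simpa [hs] using h2
  · rw [ker_quadratic_Lmul_eq_span hu hu0, codisjoint_iff, eq_top_iff]
    intro x _
    refine Submodule.mem_sup.mpr
      ⟨x - (dot x (e1 n) • e1 n + ((dot u u)⁻¹ * (dot u x - omg n u x)) • u), ?_, _,
        Submodule.mem_span_pair.mpr ⟨_, _, rfl⟩, sub_add_cancel _ _⟩
    rw [mem_ker_Lmul_sub_smul_id hu hu0, sub_eq_add_neg, ← neg_one_smul ℝ]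
    simp only [dot_add_left, dot_add_right, dot_smul_left, dot_smul_right, omg_add_right,
      omg_smul_right, dot_e1_self, omg_e1_right, omg_self, hu]
    constructor
    · ring
    · field_simp
      ring

end LeftMultiplication

/-- For `a = a₁e₁ + u` with `0 ≠ u ∈ V₀`, the space `ℝ^{2n+1}`
decomposes as the internal direct sum of the `L_a`-invariant subspaces
`E_{a₁} = ker(L_a − a₁·id) = {v : v·e₁ = 0, u·v = ω(u,v)}` of dimension `2n − 1`
and `E₂ = ker(L_a² − 2a₁L_a + (a₁² + ‖u‖²)id) = span{e₁, u}` of dimension `2`. -/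
theorem vidinli_eigenspace_decomposition (n : ℕ) (hn : 1 ≤ n) (a₁ : ℝ)
    (u a : Fin (2*n+1) → ℝ) (hu : dot u (e1 n) = 0) (hu0 : u ≠ 0)
    (ha : a = a₁ • e1 n + u) :
    (∀ v : Fin (2*n+1) → ℝ,
        v ∈ LinearMap.ker (Lmul n a - a₁ • LinearMap.id) ↔
          (dot v (e1 n) = 0 ∧ dot u v = omg n u v)) ∧
    Module.finrank ℝ ↥(LinearMap.ker (Lmul n a - a₁ • LinearMap.id)) = 2*n - 1 ∧
    LinearMap.ker ((Lmul n a) ∘ₗ (Lmul n a) - (2*a₁) • (Lmul n a)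
        + (a₁^2 + dot u u) • LinearMap.id)
      = Submodule.span ℝ {e1 n, u} ∧
    Module.finrank ℝ ↥(LinearMap.ker ((Lmul n a) ∘ₗ (Lmul n a)
        - (2*a₁) • (Lmul n a) + (a₁^2 + dot u u) • LinearMap.id)) = 2 ∧
    IsCompl (LinearMap.ker (Lmul n a - a₁ • LinearMap.id))
      (LinearMap.ker ((Lmul n a) ∘ₗ (Lmul n a) - (2*a₁) • (Lmul n a)
        + (a₁^2 + dot u u) • LinearMap.id)) ∧
    (∀ v ∈ LinearMap.ker (Lmul n a - a₁ • LinearMap.id),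
        vprod n a v ∈ LinearMap.ker (Lmul n a - a₁ • LinearMap.id)) ∧
    (∀ v ∈ LinearMap.ker ((Lmul n a) ∘ₗ (Lmul n a) - (2*a₁) • (Lmul n a)
        + (a₁^2 + dot u u) • LinearMap.id),
        vprod n a v ∈ LinearMap.ker ((Lmul n a) ∘ₗ (Lmul n a)
          - (2*a₁) • (Lmul n a) + (a₁^2 + dot u u) • LinearMap.id)) := by
  subst ha
  have hspan := ker_quadratic_Lmul_eq_span hu hu0 a₁
  have hcompl := isCompl_ker_Lmul hu hu0 a₁
  have hdim : Module.finrank ℝ (Submodule.span ℝ {e1 n, u}) = 2 := by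
    have h := finrank_span_eq_card (linearIndependent_e1_pair hu hu0)
    rwa [Matrix.range_cons_cons_empty, Fintype.card_fin] at h
  refine ⟨mem_ker_Lmul_sub_smul_id hu hu0 a₁, ?_, hspan, hspan ▸ hdim, hcompl, ?_, ?_⟩
  · have h := Submodule.finrank_add_eq_of_isCompl hcompl
    rw [hspan, hdim, Module.finrank_fin_fun] at h
    omega
  · intro v hv
    have h : vprod n (a₁ • e1 n + u) v = a₁ • v := sub_eq_zero.mp hv
    rw [h]
    exact Submodule.smul_mem _ _ hv
  · intro v hv
    rw [LinearMap.mem_ker] at hv ⊢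
    set L := Lmul n (a₁ • e1 n + u)
    change (L ∘ₗ L - (2*a₁) • L + (a₁^2 + dot u u) • LinearMap.id :
      Module.End ℝ (Fin (2*n+1) → ℝ)) (L v) = 0
    simpa using congrArg L hv
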